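/- LB_Yi is a lower bound: for any window size W ≥ 0, writing B_max = max_j B_j and B_min = min_j B_j, Σ_{i=1}^{L} y_i ≤ DTW²_W(A,B), where y_i = δ(A_i,B_max) if A_i > B_max, y_i = δ(A_i,B_min) if A_i < B_min, and y_i = 0 otherwise. -/

import Mathlib

noncomputable section

/-- Squared pointwise cost. -/
def delta (x y : ℝ) : ℝ := (x - y) ^ 2

/-- Continuity/monotonicity step of a warping path. -/
def Step (q r : ℕ × ℕ) : Prop :=
  r = (q.1 + 1, q.2) ∨ r = (q.1, q.2 + 1) ∨ r = (q.1 + 1, q.2 + 1)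

/-- A `W`-warping path for series of length `L` (1-based indices). -/
def IsWarpingPath (L W : ℕ) (p : List (ℕ × ℕ)) : Prop :=
  p.head? = some (1, 1) ∧ p.getLast? = some (L, L) ∧ List.Chain' Step p ∧
    ∀ q ∈ p, 1 ≤ q.1 ∧ q.1 ≤ L ∧ 1 ≤ q.2 ∧ q.2 ≤ L ∧ ((q.1 : ℤ) - (q.2 : ℤ)).natAbs ≤ W

/-- Cost of a warping path. -/
def pathCost (A B : ℕ → ℝ) (p : List (ℕ × ℕ)) : ℝ :=
  (p.map (fun q => delta (A q.1) (B q.2))).sum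

/-- `DTW²_W(A,B)`: minimum cost over all `W`-warping paths. -/
def DTW2 (L W : ℕ) (A B : ℕ → ℝ) : ℝ :=
  sInf (pathCost A B '' {p | IsWarpingPath L W p})

/-- Left band `ℒ^W_i`. -/
def leftBand (W i : ℕ) : Finset (ℕ × ℕ) :=
  (Finset.Icc (max 1 (i - W)) i).image (fun j => (j, i)) ∪
    (Finset.Icc (max 1 (i - W)) i).image (fun k => (i, k))

/-- Right band `ℛ^W_i`. -/
def rightBand (L W i : ℕ) : Finset (ℕ × ℕ) :=
  (Finset.Icc i (min L (i + W))).image (fun j => (j, i)) ∪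
    (Finset.Icc i (min L (i + W))).image (fun k => (i, k))

/-- Vertical band `𝒱_i`. -/
def vertBand (L W i : ℕ) : Finset (ℕ × ℕ) :=
  (Finset.Icc (max 1 (i - W)) (min L (i + W))).image (fun j => (i, j))

/-- Minimum of `δ(A_j, B_k)` over a (finite, nonempty) band of pairs `(j,k)`. -/
def bandMin (A B : ℕ → ℝ) (s : Finset (ℕ × ℕ)) : ℝ :=
  sInf ((fun q => delta (A q.1) (B q.2)) '' (s : Set (ℕ × ℕ)))

/-- Upper envelope `𝕌^B_i`. -/
def upperEnv (L W : ℕ) (B : ℕ → ℝ) (i : ℕ) : ℝ :=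
  sSup (B '' Set.Icc (max 1 (i - W)) (min L (i + W)))

/-- Lower envelope `𝕃^B_i`. -/
def lowerEnv (L W : ℕ) (B : ℕ → ℝ) (i : ℕ) : ℝ :=
  sInf (B '' Set.Icc (max 1 (i - W)) (min L (i + W)))

/-- LB_Keogh term `κ_i`. -/
def kappa (L W : ℕ) (A B : ℕ → ℝ) (i : ℕ) : ℝ :=
  if upperEnv L W B i < A i then delta (A i) (upperEnv L W B i)
  else if A i < lowerEnv L W B i then delta (A i) (lowerEnv L W B i)
  else 0
theorem exists_mem_fst_eq_of_isChain {p : List (ℕ × ℕ)} (hp : List.IsChain Step p)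
    {q r : ℕ × ℕ} (hq : p.head? = some q) (hr : p.getLast? = some r) {i : ℕ}
    (hqi : q.1 ≤ i) (hir : i ≤ r.1) : ∃ x ∈ p, x.1 = i := by
  induction p generalizing q with
  | nil => simp at hq
  | cons a t ih =>
    obtain rfl : a = q := by simpa using hq
    by_cases hai : a.1 = i
    · exact ⟨a, List.mem_cons_self, hai⟩
    cases t with
    | nil =>
      obtain rfl : a = r := by simpa using hr
      omega
    | cons b t =>
      rw [List.isChain_cons_cons] at hp
      have hb : b.1 ≤ i := by
        rcases hp.1 with h | h | h <;> rw [h] <;> dsimp only <;> omega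
      obtain ⟨x, hx, hxi⟩ := ih hp.2 rfl (by simpa using hr) hb
      exact ⟨x, List.mem_cons_of_mem _ hx, hxi⟩

theorem sum_le_list_sum_map_of_subset {α : Type*} [DecidableEq α] {s : Finset α} {l : List α}
    {f : α → ℝ} (hs : s ⊆ l.toFinset) (hf : ∀ a, 0 ≤ f a) :
    ∑ a ∈ s, f a ≤ (l.map f).sum := by
  rw [Finset.sum_list_map_count]
  refine (Finset.sum_le_sum_of_subset_of_nonneg hs fun a _ _ => hf a).trans
    (Finset.sum_le_sum fun a ha => ?_)
  have h : 1 ≤ l.count a := List.one_le_count_iff.2 (List.mem_toFinset.1 ha)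
  simpa using nsmul_le_nsmul_left (hf a) h

theorem exists_isWarpingPath {L : ℕ} (W : ℕ) (hL : 1 ≤ L) : ∃ p, IsWarpingPath L W p := by
  induction L, hL using Nat.le_induction with
  | base => exact ⟨[(1, 1)], rfl, rfl, List.isChain_singleton _, by simp⟩
  | succ n hn ih =>
    obtain ⟨p, hhead, hlast, hchain, hmem⟩ := ih
    refine ⟨p ++ [(n + 1, n + 1)], by simp [hhead], by simp, ?_, fun q hq => ?_⟩
    · refine List.IsChain.append hchain (List.isChain_singleton _) fun x hx y hy => ?_
      rw [hlast] at hx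
      simp only [Option.mem_def, Option.some.injEq, List.head?_cons] at hx hy
      subst hx hy
      exact Or.inr (Or.inr rfl)
    · rcases List.mem_append.1 hq with h | h
      · have := hmem q h
        omega
      · obtain rfl : q = (n + 1, n + 1) := by simpa using h
        simp

theorem delta_nonneg (x y : ℝ) : 0 ≤ delta x y := sq_nonneg _

theorem ite_delta_le_delta {x y l u : ℝ} (hl : l ≤ y) (hu : y ≤ u) :
    (if u < x then delta x u else if x < l then delta x l else 0) ≤ delta x y := by
  split_ifs with h₁ h₂
  · unfold delta
    nlinarith
  · unfold delta
    nlinarith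
  · exact delta_nonneg x y

/-- LB_Yi is a lower bound on `DTW²_W(A,B)`. -/
theorem lbYi_lower_bound (L W : ℕ) (hL : 1 ≤ L) (A B : ℕ → ℝ) :
    (∑ i ∈ Finset.Icc 1 L,
        if sSup (B '' Set.Icc 1 L) < A i then delta (A i) (sSup (B '' Set.Icc 1 L))
        else if A i < sInf (B '' Set.Icc 1 L) then delta (A i) (sInf (B '' Set.Icc 1 L))
        else 0) ≤
    DTW2 L W A B := by
  refine le_csInf (Set.Nonempty.image _ (exists_isWarpingPath W hL)) ?_
  rintro _ ⟨p, ⟨hhead, hlast, hchain, hmem⟩, rfl⟩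
  have hfin : (B '' Set.Icc 1 L).Finite := (Set.finite_Icc 1 L).image B
  set f : ℕ → ℝ := fun i =>
    if sSup (B '' Set.Icc 1 L) < A i then delta (A i) (sSup (B '' Set.Icc 1 L))
    else if A i < sInf (B '' Set.Icc 1 L) then delta (A i) (sInf (B '' Set.Icc 1 L))
    else 0 with hf
  have hnonneg (i : ℕ) : 0 ≤ f i := by
    simp only [hf]
    split_ifs <;> first | exact delta_nonneg _ _ | exact le_rfl
  have hsub : Finset.Icc 1 L ⊆ (p.map Prod.fst).toFinset := fun i hi => by
    rw [Finset.mem_Icc] at hi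
    rw [List.mem_toFinset, List.mem_map]
    exact exists_mem_fst_eq_of_isChain hchain hhead hlast hi.1 hi.2
  refine (sum_le_list_sum_map_of_subset hsub hnonneg).trans ?_
  rw [List.map_map]
  refine List.sum_le_sum fun q hq => ?_
  obtain ⟨-, -, h₁, h₂, -⟩ := hmem q hq
  have hB : B q.2 ∈ B '' Set.Icc 1 L := Set.mem_image_of_mem B ⟨h₁, h₂⟩
  exact ite_delta_le_delta (csInf_le hfin.bddBelow hB) (le_csSup hfin.bddAbove hB)
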